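/- Let (X,T) be an aperiodic Cantor dynamical system and let Y ⊂ X be a basic set for T. Then there exists a sequence (ξ(n))_{n≥1} of clopen Kakutani–Rokhlin partitions of X such that for all n: (i) ξ(n+1) refines ξ(n), and the atoms of the partitions ξ(n), n ≥ 1, generate the clopen topology of X; (ii) the bases are nested, B(ξ(n+1)) ⊆ B(ξ(n)), and ⋂_n B(ξ(n)) = Y; (iii) the minimal height h_n of the towers constituting ξ(n) tends to infinity as n → ∞. -/

import Mathlib

/-- A Kakutani–Rokhlin clopen partition of a Cantor system `(X, T)`: a finite disjoint
family of clopen towers `(C_k, T C_k, …, T^{h_k - 1} C_k)` covering `X`. -/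
structure KRPartition (X : Type) [TopologicalSpace X] (T : X ≃ₜ X) where
  ι : Type
  fin : Fintype ι
  nonempty : Nonempty ι
  base : ι → Set X
  ht : ι → ℕ
  ht_pos : ∀ k, 0 < ht k
  base_nonempty : ∀ k, (base k).Nonempty
  base_clopen : ∀ k, IsClopen (base k)
  disj : ∀ (k k' : ι) (i i' : ℕ), i < ht k → i' < ht k' → (k, i) ≠ (k', i') →
    Disjoint ((T.toEquiv ^ i : Equiv.Perm X) '' base k)
      ((T.toEquiv ^ i' : Equiv.Perm X) '' base k')
  cover : (⋃ k, ⋃ i : { i : ℕ // i < ht k }, (T.toEquiv ^ (i : ℕ) : Equiv.Perm X) '' base k)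
      = Set.univ

namespace KRPartition

variable {X : Type} [TopologicalSpace X] {T : X ≃ₜ X}

/-- The atoms (elements) of a Kakutani–Rokhlin partition. -/
def atoms (ξ : KRPartition X T) : Set (Set X) :=
  { A | ∃ (k : ξ.ι) (i : ℕ), i < ξ.ht k ∧ A = (T.toEquiv ^ i : Equiv.Perm X) '' ξ.base k }

/-- The base `B(ξ)` of a Kakutani–Rokhlin partition. -/
def krBase (ξ : KRPartition X T) : Set X := ⋃ k, ξ.base k

/-- `ξ'` refines `ξ` if every atom of `ξ'` is contained in an atom of `ξ`. -/
def Refines (ξ' ξ : KRPartition X T) : Prop :=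
  ∀ A ∈ ξ'.atoms, ∃ A' ∈ ξ.atoms, A ⊆ A'

end KRPartition

theorem Homeomorph.continuous_toEquiv_zpow {X : Type} [TopologicalSpace X] (T : X ≃ₜ X) (n : ℤ) :
    Continuous (T.toEquiv ^ n : Equiv.Perm X) := by
  have hpow (S : X ≃ₜ X) (m : ℕ) : Continuous (S.toEquiv ^ m : Equiv.Perm X) := by
    induction m with
    | zero => exact continuous_id
    | succ m ih =>
      rw [pow_succ]
      exact ih.comp S.continuous
  cases n with
  | ofNat m => exact hpow T m
  | negSucc m =>
    rw [zpow_negSucc, ← inv_pow]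
    exact hpow T.symm (m + 1)

theorem Homeomorph.continuous_toEquiv_pow {X : Type} [TopologicalSpace X] (T : X ≃ₜ X) (n : ℕ) :
    Continuous (T.toEquiv ^ n : Equiv.Perm X) := by
  simpa using T.continuous_toEquiv_zpow n

theorem Homeomorph.isClopen_image_toEquiv_pow {X : Type} [TopologicalSpace X] (T : X ≃ₜ X)
    (n : ℕ) {s : Set X} (hs : IsClopen s) :
    IsClopen ((T.toEquiv ^ n : Equiv.Perm X) '' s) := by
  rw [Equiv.image_eq_preimage_symm]
  have h := hs.preimage (T.continuous_toEquiv_zpow (-n))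
  rwa [zpow_neg, zpow_natCast] at h

namespace KRPartition

open Set

variable {X : Type} [TopologicalSpace X] {T : X ≃ₜ X}

theorem isClopen_of_mem_atoms (ξ : KRPartition X T) {A : Set X} (hA : A ∈ ξ.atoms) :
    IsClopen A := by
  obtain ⟨k, i, -, rfl⟩ := hA
  exact T.isClopen_image_toEquiv_pow i (ξ.base_clopen k)

theorem nonempty_of_mem_atoms (ξ : KRPartition X T) {A : Set X} (hA : A ∈ ξ.atoms) :
    A.Nonempty := by
  obtain ⟨k, i, -, rfl⟩ := hA
  exact (ξ.base_nonempty k).image _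

theorem finite_atoms (ξ : KRPartition X T) : ξ.atoms.Finite := by
  have := ξ.fin
  refine (finite_range fun p : Σ k : ξ.ι, Fin (ξ.ht k) =>
    (T.toEquiv ^ (p.2 : ℕ) : Equiv.Perm X) '' ξ.base p.1).subset ?_
  rintro _ ⟨k, i, hi, rfl⟩
  exact ⟨⟨k, i, hi⟩, rfl⟩

theorem exists_mem_atoms (ξ : KRPartition X T) (x : X) : ∃ A ∈ ξ.atoms, x ∈ A := by
  have hx : x ∈ ⋃ k, ⋃ i : { i : ℕ // i < ξ.ht k },
      (T.toEquiv ^ (i : ℕ) : Equiv.Perm X) '' ξ.base k := by simp only [ξ.cover, mem_univ]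
  obtain ⟨k, ⟨i, hi⟩, hxi⟩ := by simpa only [mem_iUnion] using hx
  exact ⟨_, ⟨k, i, hi, rfl⟩, hxi⟩

/-- Every clopen set `A` with bounded return times is the base of a Kakutani–Rokhlin partition
finer than any given finite family of clopen sets. -/
theorem exists_krBase_eq {A : Set X} (hA : IsClopen A) (hne : A.Nonempty) {M : ℕ}
    (hfwd : ∀ x, ∃ n, 0 < n ∧ n ≤ M ∧ (T.toEquiv ^ n) x ∈ A)
    (hbwd : ∀ x, ∃ n : ℕ, ∃ y ∈ A, (T.toEquiv ^ n) y = x)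
    {S : Set (Set X)} (hfin : S.Finite) (hS : ∀ s ∈ S, IsClopen s) :
    ∃ ξ : KRPartition X T, ξ.krBase = A ∧
      (∀ B ∈ ξ.atoms, ∀ s ∈ S, ∀ x ∈ B, x ∈ s → B ⊆ s) ∧
      ∀ N, (∀ x ∈ A, ∀ i, 0 < i → i ≤ N → (T.toEquiv ^ i) x ∉ A) → ∀ k, N < ξ.ht k := by
  classical
  have hfwd' (x : X) : ∃ n, 0 < n ∧ (T.toEquiv ^ n) x ∈ A :=
    (hfwd x).imp fun n h => ⟨h.1, h.2.2⟩
  let r (x : X) : ℕ := Nat.find (hfwd' x)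
  have r_pos (x : X) : 0 < r x := (Nat.find_spec (hfwd' x)).1
  have r_mem (x : X) : (T.toEquiv ^ r x) x ∈ A := (Nat.find_spec (hfwd' x)).2
  have r_le {x : X} {n : ℕ} (h0 : 0 < n) (hn : (T.toEquiv ^ n) x ∈ A) : r x ≤ n :=
    Nat.find_min' (hfwd' x) ⟨h0, hn⟩
  have r_le_M (x : X) : r x ≤ M := by
    obtain ⟨n, h0, hM, hn⟩ := hfwd x
    exact (r_le h0 hn).trans hM
  let S' : Set (Set X) := insert A S
  have : Finite S' := (hfin.insert A).to_subtype
  have hS' (s : S') : IsClopen (s : Set X) := by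
    obtain ⟨s, rfl | hs⟩ := s
    exacts [hA, hS s hs]
  let κ (x : X) : Set (Fin (M + 1) × S') :=
    {p | (T.toEquiv ^ (p.1 : ℕ)) x ∈ (p.2 : Set X)}
  have κ_iff {x y : X} (h : κ x = κ y) {i : ℕ} (hi : i ≤ M) {s : Set X} (hs : s ∈ S') :
      (T.toEquiv ^ i) x ∈ s ↔ (T.toEquiv ^ i) y ∈ s :=
    Set.ext_iff.1 h (⟨i, by omega⟩, ⟨s, hs⟩)
  have r_le_of_κ {x y : X} (h : κ x = κ y) : r x ≤ r y :=
    r_le (r_pos y) ((κ_iff h (r_le_M y) (mem_insert A S)).2 (r_mem y))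
  have r_eq {x y : X} (h : κ x = κ y) : r x = r y :=
    (r_le_of_κ h).antisymm (r_le_of_κ h.symm)
  have κ_clopen (c : Set (Fin (M + 1) × S')) : IsClopen {x | κ x = c} := by
    have hc : {x | κ x = c} = ⋂ p : Fin (M + 1) × S',
        {x | (T.toEquiv ^ (p.1 : ℕ)) x ∈ (p.2 : Set X) ↔ p ∈ c} := by
      ext x
      simp only [mem_ofPred_eq, mem_iInter, Set.ext_iff, κ]
    rw [hc]
    refine isClopen_iInter_of_finite fun p => ?_
    have hp := (hS' p.2).preimage (T.continuous_toEquiv_pow p.1)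
    by_cases hpc : p ∈ c
    · simp only [hpc, iff_true]
      exact hp
    · simp only [hpc, iff_false]
      exact hp.compl
  have key (k : κ '' A) : ∃ x ∈ A, κ x = k := k.2
  choose rep rep_mem rep_key using key
  let ξ : KRPartition X T :=
    { ι := κ '' A
      fin := Fintype.ofFinite _
      nonempty := (hne.image κ).to_subtype
      base := fun k => A ∩ {x | κ x = k}
      ht := fun k => r (rep k)
      ht_pos := fun k => r_pos _
      base_nonempty := fun k => ⟨rep k, rep_mem k, rep_key k⟩
      base_clopen := fun k => hA.inter (κ_clopen k)
      disj := by
        have aux {x y : X} {i j : ℕ} (hx : x ∈ A) (hj : j < r y) (hij : i < j)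
            (h : (T.toEquiv ^ i) x = (T.toEquiv ^ j) y) : False := by
          obtain ⟨d, rfl⟩ := Nat.exists_eq_add_of_lt hij
          rw [add_assoc, pow_add, Equiv.Perm.mul_apply, (T.toEquiv ^ i).injective.eq_iff] at h
          have := r_le (x := y) (n := d + 1) (by omega) (h ▸ hx)
          omega
        intro k k' i i' hi hi' hne
        rw [Set.disjoint_left]
        rintro _ ⟨x, ⟨hx, hxk⟩, rfl⟩ ⟨y, ⟨hy, hyk⟩, h⟩
        rw [← r_eq (hxk.trans (rep_key k).symm)] at hi
        rw [← r_eq (hyk.trans (rep_key k').symm)] at hi'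
        rcases lt_trichotomy i i' with hlt | rfl | hlt
        · exact aux hx hi' hlt h.symm
        · rw [(T.toEquiv ^ i).injective.eq_iff] at h
          subst h
          exact hne (by rw [Subtype.ext (hxk.symm.trans hyk)])
        · exact aux hy hi hlt h
      cover := by
        refine eq_univ_of_forall fun x => ?_
        obtain ⟨y, hy, hyx⟩ := Nat.find_spec (hbwd x)
        set n := Nat.find (hbwd x)
        have hlt : n < r y := by
          by_contra! hle
          obtain ⟨d, hd⟩ := Nat.exists_eq_add_of_le hle
          have := Nat.find_min' (hbwd x) (m := d)
            ⟨(T.toEquiv ^ r y) y, r_mem y, by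
              rw [← Equiv.Perm.mul_apply, ← pow_add, add_comm, ← hd, hyx]⟩
          have := r_pos y
          omega
        simp only [mem_iUnion]
        refine ⟨⟨κ y, mem_image_of_mem κ hy⟩, ⟨n, ?_⟩, y, ⟨hy, rfl⟩, hyx⟩
        rwa [r_eq (rep_key ⟨κ y, mem_image_of_mem κ hy⟩)] }
  refine ⟨ξ, ?_, ?_, ?_⟩
  · ext x
    simp only [krBase, mem_iUnion]
    exact ⟨fun ⟨k, hk⟩ => hk.1, fun hx => ⟨⟨κ x, mem_image_of_mem κ hx⟩, hx, rfl⟩⟩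
  · rintro _ ⟨k, i, hi, rfl⟩ s hs _ ⟨x, hx, rfl⟩ hxs _ ⟨y, hy, rfl⟩
    exact (κ_iff (hx.2.trans hy.2.symm) (hi.le.trans (r_le_M _)) (mem_insert_of_mem A hs)).1 hxs
  · intro N hN k
    by_contra! hle
    exact hN _ (rep_mem k) _ (r_pos _) hle (r_mem _)

theorem exists_bounded_return [CompactSpace X] {A : Set X} (hA : IsClopen A)
    (hsec : ∀ x : X, ∃ n : ℤ, (T.toEquiv ^ n) x ∈ A) :
    (∃ M, ∀ x, ∃ n, 0 < n ∧ n ≤ M ∧ (T.toEquiv ^ n) x ∈ A) ∧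
      ∀ x, ∃ n : ℕ, ∃ y ∈ A, (T.toEquiv ^ n) y = x := by
  obtain ⟨t, ht⟩ := isCompact_univ.elim_finite_subcover
    (fun n : ℤ => (T.toEquiv ^ n : Equiv.Perm X) ⁻¹' A)
    (fun n => hA.isOpen.preimage (T.continuous_toEquiv_zpow n))
    (fun x _ => mem_iUnion.2 (hsec x))
  obtain ⟨N, hN⟩ : ∃ N : ℕ, ∀ n ∈ t, n.natAbs ≤ N :=
    ⟨t.sup Int.natAbs, fun n hn => Finset.le_sup (f := Int.natAbs) hn⟩
  have hbd (x : X) : ∃ n : ℤ, n.natAbs ≤ N ∧ (T.toEquiv ^ n) x ∈ A := by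
    obtain ⟨n, hn, hx⟩ := mem_iUnion₂.1 (ht (mem_univ x))
    exact ⟨n, hN n hn, hx⟩
  refine ⟨⟨2 * N + 1, fun x => ?_⟩, fun x => ?_⟩
  · obtain ⟨n, hn, hx⟩ := hbd ((T.toEquiv ^ (N + 1 : ℤ)) x)
    rw [← Equiv.Perm.mul_apply, ← zpow_add] at hx
    obtain ⟨m, hm⟩ := Int.eq_ofNat_of_zero_le (a := n + (N + 1)) (by omega)
    rw [hm] at hx
    exact ⟨m, by omega, by omega, by simpa using hx⟩
  · obtain ⟨n, hn, hx⟩ := hbd ((T.toEquiv ^ (-N : ℤ)) x)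
    obtain ⟨m, hm⟩ := Int.eq_ofNat_of_zero_le (a := N - n) (by omega)
    refine ⟨m, _, hx, ?_⟩
    rw [← zpow_natCast, ← hm, ← Equiv.Perm.mul_apply,
      ← Equiv.Perm.mul_apply, ← zpow_add, ← zpow_add]
    simp

end KRPartition


/-- **Medynets.** For an aperiodic Cantor system `(X, T)` with a basic set `Y` there is a
sequence of Kakutani–Rokhlin clopen partitions `ξ(n)` such that: (i) `ξ(n+1)` refines
`ξ(n)` and the atoms generate the clopen topology on `X`; (ii) the bases are nested with
intersection `Y`; (iii) the minimal height of the towers of `ξ(n)` tends to infinity. -/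
theorem exists_KR_partition_sequence
    (X : Type) [TopologicalSpace X] [CompactSpace X]
    [TopologicalSpace.MetrizableSpace X] [TotallyDisconnectedSpace X]
    [PerfectSpace X] [Nonempty X]
    (T : X ≃ₜ X)
    (haper : ∀ x : X, (Set.range fun n : ℤ => (T.toEquiv ^ n) x).Infinite)
    (Y : Set X) (hYne : Y.Nonempty) (hYclosed : IsClosed Y)
    (hYdisj : ∀ i : ℤ, i ≠ 0 → Y ∩ ((T.toEquiv ^ i : Equiv.Perm X) '' Y) = ∅)
    (hYsection : ∀ A : Set X, IsClopen A → Y ⊆ A → ∀ x : X, ∃ n : ℤ, (T.toEquiv ^ n) x ∈ A) :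
    ∃ ξ : ℕ → KRPartition X T,
      (∀ n, (ξ (n + 1)).Refines (ξ n)) ∧
      (∀ U : Set X, IsOpen U → ∀ x ∈ U, ∃ (n : ℕ) (A : Set X),
        A ∈ (ξ n).atoms ∧ x ∈ A ∧ A ⊆ U) ∧
      (∀ n, (ξ (n + 1)).krBase ⊆ (ξ n).krBase) ∧
      (⋂ n, (ξ n).krBase) = Y ∧
      Filter.Tendsto (fun n => ⨅ k : (ξ n).ι, (ξ n).ht k) Filter.atTop Filter.atTop := by
  classical
  have hsc : SecondCountableTopology X := by
    let := TopologicalSpace.metrizableSpaceMetric X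
    infer_instance
  have : Countable (TopologicalSpace.Clopens X) :=
    TopologicalSpace.Clopens.countable_iff_secondCountable.2 hsc
  obtain ⟨U, hU⟩ := exists_surjective_nat (TopologicalSpace.Clopens X)
  let V (n : ℕ) : Set X := ⋂ k ∈ {k ∈ Finset.range (n + 1) | Y ⊆ U k}, (U k : Set X)
  have V_clopen (n : ℕ) : IsClopen (V n) := isClopen_biInter_finset fun k _ => (U k).isClopen
  have Y_subset (n : ℕ) : Y ⊆ V n :=
    Set.subset_iInter₂ fun k hk => (Finset.mem_filter.1 hk).2
  have V_subset {m n : ℕ} (hmn : m ≤ n) (hm : Y ⊆ U m) : V n ⊆ U m :=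
    Set.biInter_subset_of_mem (by simpa using ⟨by omega, hm⟩)
  have V_anti (n : ℕ) : V (n + 1) ⊆ V n :=
    Set.subset_iInter₂ fun k hk => by
      simp only [Finset.mem_filter, Finset.mem_range] at hk
      exact V_subset (by omega) hk.2
  have V_eventually {A : Set X} (hA : IsClopen A) (hYA : Y ⊆ A) :
      ∀ᶠ n in Filter.atTop, V n ⊆ A := by
    obtain ⟨m, hm⟩ := hU ⟨A, hA⟩
    have hmA : (U m : Set X) = A := by rw [hm]; rfl
    filter_upwards [Filter.eventually_ge_atTop m] with n hn
    exact hmA ▸ V_subset hn (hmA.symm ▸ hYA)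
  have V_return (i : ℕ) (hi : 0 < i) :
      ∀ᶠ n in Filter.atTop, ∀ x ∈ V n, (T.toEquiv ^ i) x ∉ V n := by
    have hc := T.continuous_toEquiv_pow i
    have hYO : Y ⊆ ((T.toEquiv ^ i : Equiv.Perm X) '' Y)ᶜ := by
      rw [Set.subset_compl_iff_disjoint_right, Set.disjoint_iff_inter_eq_empty]
      simpa using hYdisj i (by omega)
    obtain ⟨C, hC, hYC, hCO⟩ := exists_clopen_of_closed_subset_open hYclosed
      (hYclosed.isCompact.image hc).isClosed.isOpen_compl hYO
    filter_upwards [V_eventually (hC.diff (hC.preimage hc)) fun y hy =>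
      ⟨hYC hy, fun h => hCO h (Set.mem_image_of_mem _ hy)⟩] with n hn x hx hxi
    exact (hn hx).2 (hn hxi).1
  have step (n : ℕ) (S : Set (Set X)) (hfin : S.Finite) (hS : ∀ s ∈ S, IsClopen s) :
      ∃ ξ : KRPartition X T, ξ.krBase = V n ∧
        (∀ B ∈ ξ.atoms, ∀ s ∈ S, ∀ x ∈ B, x ∈ s → B ⊆ s) ∧
        ∀ N, (∀ x ∈ V n, ∀ i, 0 < i → i ≤ N → (T.toEquiv ^ i) x ∉ V n) →
          ∀ k, N < ξ.ht k := by
    obtain ⟨⟨M, hM⟩, hbwd⟩ := KRPartition.exists_bounded_return (V_clopen n)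
      (hYsection (V n) (V_clopen n) (Y_subset n))
    exact KRPartition.exists_krBase_eq (V_clopen n) (hYne.mono (Y_subset n)) hM hbwd hfin hS
  obtain ⟨ξ₀, -⟩ := step 0 ∅ Set.finite_empty (by simp)
  have next (n : ℕ) (ξ : KRPartition X T) :=
    step n (insert (U n : Set X) ξ.atoms) (ξ.finite_atoms.insert _) (by
      rintro s (rfl | hs)
      exacts [(U n).isClopen, ξ.isClopen_of_mem_atoms hs])
  choose F F_base F_fine F_ht using next
  let ζ (n : ℕ) : KRPartition X T := Nat.rec ξ₀ (fun n ξ => F n ξ) n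
  have base_eq (n : ℕ) : (ζ (n + 1)).krBase = V n := F_base n (ζ n)
  refine ⟨fun n => ζ (n + 1), fun n B hB => ?_, fun O hO x hx => ?_, fun n => ?_, ?_, ?_⟩
  · obtain ⟨x, hx⟩ := (ζ (n + 2)).nonempty_of_mem_atoms hB
    obtain ⟨B', hB', hxB'⟩ := (ζ (n + 1)).exists_mem_atoms x
    exact ⟨B', hB', F_fine (n + 1) (ζ (n + 1)) B hB B' (Set.mem_insert_of_mem _ hB') x hx hxB'⟩
  · obtain ⟨C, hC, hxC, hCO⟩ := compact_exists_isClopen_in_isOpen hO hx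
    obtain ⟨n, hn⟩ := hU ⟨C, hC⟩
    have hnC : (U n : Set X) = C := by rw [hn]; rfl
    obtain ⟨B, hB, hxB⟩ := (ζ (n + 1)).exists_mem_atoms x
    exact ⟨n, B, hB, hxB, (F_fine n (ζ n) B hB (U n) (Set.mem_insert _ _) x hxB
      (hnC.symm ▸ hxC)).trans (hnC.symm ▸ hCO)⟩
  · rw [base_eq, base_eq]
    exact V_anti n
  · simp only [base_eq]
    refine Set.Subset.antisymm (fun x hx => ?_) (Set.subset_iInter Y_subset)
    by_contra hxY
    obtain ⟨C, hC, hYC, hCx⟩ := exists_clopen_of_closed_subset_open hYclosed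
      (isOpen_compl_singleton (x := x)) (Set.subset_compl_singleton_iff.2 hxY)
    obtain ⟨n, hn⟩ := (V_eventually hC hYC).exists
    exact hCx (hn (Set.mem_iInter.1 hx n)) rfl
  · refine Filter.tendsto_atTop.2 fun N => ?_
    have hev : ∀ᶠ n in Filter.atTop, ∀ i ∈ Finset.Icc 1 N,
        ∀ x ∈ V n, (T.toEquiv ^ i) x ∉ V n :=
      (Filter.eventually_all_finset _).2 fun i hi => V_return i (Finset.mem_Icc.1 hi).1
    filter_upwards [hev] with n hn
    have := (ζ (n + 1)).nonempty
    exact le_ciInf fun k => (F_ht n (ζ n) N (fun x hx i h0 hi =>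
      hn i (Finset.mem_Icc.2 ⟨h0, hi⟩) x hx) k).le
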